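/- arXiv:2510.10359 — 3 statements merged into one kernel-verified Lean document; each statement's English description precedes it below -/
import Mathlib

section
/- Fefferman–Phong-type inequality with Morrey data: if 1 ≤ p < n, n−p < λ < n, and f ∈ L^{1,λ}(Ω), then there exists a constant c > 0 depending only on p, λ, n, such that for every ball B ⊂ Ω of radius r > 0 and every φ ∈ W^{1,p}_0(B), ∫_B |f| |φ|^p dx ≤ c · r^{λ−n+p} · ‖f‖_{L^{1,λ}(Ω)} · ∫_B |Dφ|^p dx. -/
open MeasureTheory Metric Set
open scoped RealInnerProductSpace

open scoped ENNReal

/-- Jensen's inequality for the measure with density `w`. -/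
theorem lintegral_rpow_le_weight {α : Type*} [MeasurableSpace α] {μ : Measure α}
    {g w : α → ℝ≥0∞} (hg : Measurable g) (hw : Measurable w)
    (hw0 : ∀ᵐ a ∂μ, w a ≠ 0) (hwt : ∀ᵐ a ∂μ, w a ≠ ∞) {p : ℝ} (hp : 1 ≤ p) :
    (∫⁻ a, g a ∂μ) ^ p ≤
      (∫⁻ a, w a ∂μ) ^ (p - 1) * ∫⁻ a, g a ^ p * w a ^ (1 - p) ∂μ := by
  have hp0 : 0 < p := by linarith
  have key := ENNReal.lintegral_mul_norm_pow_le (μ := μ)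
    (f := fun a => g a ^ p * w a ^ (1 - p)) (g := w) (by fun_prop) (by fun_prop)
    (p := 1 / p) (q := 1 - 1 / p) (by positivity)
    (by rw [sub_nonneg, div_le_one hp0]; exact hp) (by ring)
  have heq : ∫⁻ a, g a ∂μ
      = ∫⁻ a, (g a ^ p * w a ^ (1 - p)) ^ (1 / p) * w a ^ (1 - 1 / p) ∂μ := by
    refine lintegral_congr_ae ?_
    filter_upwards [hw0, hwt] with a h0 ht
    rw [ENNReal.mul_rpow_of_nonneg _ _ (by positivity), ← ENNReal.rpow_mul, ← ENNReal.rpow_mul,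
      mul_assoc, ← ENNReal.rpow_add _ _ h0 ht]
    have h1 : p * (1 / p) = 1 := by field_simp
    have h2 : (1 - p) * (1 / p) + (1 - 1 / p) = 0 := by field_simp; ring
    rw [h1, h2]; simp
  rw [heq]
  refine (ENNReal.rpow_le_rpow key hp0.le).trans (le_of_eq ?_)
  rw [ENNReal.mul_rpow_of_nonneg _ _ hp0.le, ← ENNReal.rpow_mul, ← ENNReal.rpow_mul]
  have h1 : 1 / p * p = 1 := by field_simp
  have h2 : (1 - 1 / p) * p = p - 1 := by field_simp
  rw [h1, h2, ENNReal.rpow_one, mul_comm]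

theorem lintegral_Ioc_rpow {T a : ℝ} (hT : 0 ≤ T) (ha : -1 < a) :
    ∫⁻ t in Ioc 0 T, ENNReal.ofReal (t ^ a) = ENNReal.ofReal (T ^ (a + 1) / (a + 1)) := by
  rw [← ofReal_integral_eq_lintegral_ofReal, ← intervalIntegral.integral_of_le hT,
    integral_rpow (Or.inl ha), Real.zero_rpow (by linarith), sub_zero]
  · exact (intervalIntegrable_iff_integrableOn_Ioc_of_le hT).1
      (intervalIntegral.intervalIntegrable_rpow' ha)
  · filter_upwards [ae_restrict_mem measurableSet_Ioc] with t ht using Real.rpow_nonneg ht.1.le _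

section NormedSpace

variable {E : Type*} [NormedAddCommGroup E] [NormedSpace ℝ E]

theorem enorm_le_lintegral_fderiv_line {φ : E → ℝ} (hφ : ContDiff ℝ 1 φ) (x v : E) {T : ℝ}
    (hT : 0 ≤ T) (h0 : φ (x + T • v) = 0) :
    ‖φ x‖ₑ ≤ ∫⁻ t in Ioc 0 T, ‖fderiv ℝ φ (x + t • v)‖ₑ * ‖v‖ₑ := by
  have hc : Continuous (fderiv ℝ φ) := hφ.continuous_fderiv one_ne_zero
  have hd : ∀ t ∈ uIcc 0 T,
      HasDerivAt (fun t : ℝ => φ (x + t • v)) (fderiv ℝ φ (x + t • v) v) t := by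
    intro t _
    have h1 : HasDerivAt (fun t : ℝ => x + t • v) v t := by
      simpa using ((hasDerivAt_id t).smul_const v).const_add x
    exact ((hφ.differentiable one_ne_zero _).hasFDerivAt).comp_hasDerivAt t h1
  have hcont : Continuous fun t : ℝ => fderiv ℝ φ (x + t • v) v := by fun_prop
  have h := intervalIntegral.integral_eq_sub_of_hasDerivAt hd (hcont.intervalIntegrable _ _)
  rw [intervalIntegral.integral_of_le hT, h0] at h
  have hx : ‖φ x‖ₑ = ‖∫ t in Ioc 0 T, fderiv ℝ φ (x + t • v) v‖ₑ := by
    rw [h]; simp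
  rw [hx]
  refine (enorm_integral_le_lintegral_enorm _).trans (lintegral_mono fun t => ?_)
  exact ContinuousLinearMap.le_opENorm _ _

/-- Weighted one-dimensional Hardy-type bound along a ray. -/
theorem enorm_rpow_le_lintegral_fderiv_line {φ : E → ℝ} (hφ : ContDiff ℝ 1 φ) (x v : E) {T : ℝ}
    (hT : 0 ≤ T) (h0 : φ (x + T • v) = 0) {p : ℝ} (hp : 1 ≤ p) (s : ℝ) :
    ‖φ x‖ₑ ^ p ≤ ‖v‖ₑ ^ p * (∫⁻ t in Ioc 0 T, ENNReal.ofReal (t ^ (-s))) ^ (p - 1) *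
      ∫⁻ t in Ioc 0 T, ‖fderiv ℝ φ (x + t • v)‖ₑ ^ p * ENNReal.ofReal (t ^ (s * (p - 1))) := by
  have hc : Continuous (fderiv ℝ φ) := hφ.continuous_fderiv one_ne_zero
  have hcont : Continuous fun t : ℝ => ‖fderiv ℝ φ (x + t • v)‖ₑ := by fun_prop
  have h := enorm_le_lintegral_fderiv_line hφ x v hT h0
  rw [lintegral_mul_const _ hcont.measurable] at h
  refine (ENNReal.rpow_le_rpow h (by linarith)).trans ?_
  rw [ENNReal.mul_rpow_of_nonneg _ _ (by linarith), mul_comm, mul_assoc]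
  gcongr
  refine (lintegral_rpow_le_weight (w := fun t => ENNReal.ofReal (t ^ (-s))) hcont.measurable
    (by fun_prop) ?_ ?_ hp).trans (le_of_eq ?_)
  · filter_upwards [ae_restrict_mem measurableSet_Ioc] with t ht
    exact (ENNReal.ofReal_pos.2 (Real.rpow_pos_of_pos ht.1 _)).ne'
  · exact Filter.Eventually.of_forall fun _ => ENNReal.ofReal_ne_top
  · congr 1
    refine setLIntegral_congr_fun measurableSet_Ioc fun t ht => ?_
    rw [ENNReal.ofReal_rpow_of_pos (Real.rpow_pos_of_pos ht.1 _), ← Real.rpow_mul ht.1.le]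
    ring_nf

variable [MeasurableSpace E] [BorelSpace E]

omit [NormedSpace ℝ E] in
theorem lintegral_lintegral_ball_swap [SecondCountableTopology E] {μ ν : Measure E} [SFinite μ]
    [SFinite ν] {H : E → ℝ≥0∞} (hH : Measurable H) (ρ : ℝ) :
    ∫⁻ x, ∫⁻ y in ball x ρ, H y ∂ν ∂μ = ∫⁻ y, H y * μ (ball y ρ) ∂ν := by
  have hm : MeasurableSet {q : E × E | dist q.2 q.1 < ρ} :=
    measurableSet_lt (by fun_prop) (by fun_prop)
  have h1 : ∀ x, ∫⁻ y in ball x ρ, H y ∂ν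
      = ∫⁻ y, {q : E × E | dist q.2 q.1 < ρ}.indicator (fun q => H q.2) (x, y) ∂ν := by
    intro x
    rw [← lintegral_indicator measurableSet_ball]
    rfl
  simp_rw [h1]
  have hK : Measurable (Function.uncurry fun x y =>
      {q : E × E | dist q.2 q.1 < ρ}.indicator (fun q => H q.2) (x, y)) :=
    (hH.comp measurable_snd).indicator hm
  rw [lintegral_lintegral_swap hK.aemeasurable]
  refine lintegral_congr fun y => ?_
  have h2 : ∀ x, {q : E × E | dist q.2 q.1 < ρ}.indicator (fun q => H q.2) (x, y)
      = (ball y ρ).indicator (fun _ => H y) x := by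
    intro x
    simp only [indicator, mem_ofPred_eq, mem_ball, dist_comm x y]
  simp_rw [h2]
  rw [lintegral_indicator measurableSet_ball, setLIntegral_const]

variable [FiniteDimensional ℝ E]

theorem setLIntegral_ball_comp_add_smul (ν : Measure E) [ν.IsAddHaarMeasure] {H : E → ℝ≥0∞}
    (hH : Measurable H) (x : E) {t : ℝ} (ht : 0 < t) (R : ℝ) :
    ∫⁻ v in ball 0 R, H (x + t • v) ∂ν =
      ENNReal.ofReal (t ^ (-(Module.finrank ℝ E : ℝ))) * ∫⁻ y in ball x (t * R), H y ∂ν := by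
  rw [← lintegral_indicator measurableSet_ball, ← lintegral_indicator measurableSet_ball,
    ← lintegral_add_left_eq_self ((ball x (t * R)).indicator H) x]
  have hK : Measurable fun z => (ball x (t * R)).indicator H (x + z) :=
    (hH.indicator measurableSet_ball).comp (measurable_const_add x)
  have h1 : ∀ v, (ball 0 R).indicator (fun v => H (x + t • v)) v
      = (fun z => (ball x (t * R)).indicator H (x + z)) (t • v) := by
    intro v
    simp only [indicator, mem_ball, dist_zero_right, dist_self_add_left, norm_smul,
      Real.norm_eq_abs, abs_of_pos ht, mul_lt_mul_iff_right₀ ht]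
  simp_rw [h1]
  rw [← lintegral_map hK (measurable_const_smul t), Measure.map_addHaar_smul ν ht.ne',
    lintegral_smul_measure, smul_eq_mul, Real.rpow_neg ht.le, Real.rpow_natCast,
    abs_of_pos (by positivity)]

/-- Trace inequality for a measure with ball growth `ρ ^ lam`, with explicit constant. -/
theorem lintegral_enorm_rpow_le_of_growth (ν : Measure E) [ν.IsAddHaarMeasure]
    {μ : Measure E} [SFinite μ] {φ : E → ℝ} (hφ : ContDiff ℝ 1 φ) {x0 : E} {r : ℝ} (hr : 0 < r)
    (hsupp : tsupport φ ⊆ ball x0 r) (hμ : ∀ᵐ x ∂μ, x ∈ ball x0 r) {M : ℝ≥0∞} {lam : ℝ}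
    (hgrowth : ∀ y ∈ ball x0 r, ∀ ρ > 0, μ (ball y ρ) ≤ M * ENNReal.ofReal (ρ ^ lam))
    {p : ℝ} (hp : 1 ≤ p) (s : ℝ) :
    ν (ball 0 2 \ ball 0 1) * ∫⁻ x, ‖φ x‖ₑ ^ p ∂μ ≤
      2 ^ p * (∫⁻ t in Ioc 0 (2 * r), ENNReal.ofReal (t ^ (-s))) ^ (p - 1) *
      ((∫⁻ t in Ioc 0 (2 * r),
        ENNReal.ofReal (2 ^ lam) * ENNReal.ofReal (t ^ (s * (p - 1) - Module.finrank ℝ E + lam))) *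
      (M * ∫⁻ y, ‖fderiv ℝ φ y‖ₑ ^ p ∂ν)) := by
  have hc : Continuous (fderiv ℝ φ) := hφ.continuous_fderiv one_ne_zero
  set H : E → ℝ≥0∞ := fun y => ‖fderiv ℝ φ y‖ₑ ^ p with hHdef
  have hH : Measurable H := by
    have : Measurable fun y => ‖fderiv ℝ φ y‖ₑ := hc.enorm.measurable
    exact this.pow_const p
  set C := 2 ^ p * (∫⁻ t in Ioc 0 (2 * r), ENNReal.ofReal (t ^ (-s))) ^ (p - 1) with hC
  set n := Module.finrank ℝ E
  have hp0 : 0 ≤ p := by linarith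
  have hpt : ∀ x ∈ ball x0 r, ν (ball 0 2 \ ball 0 1) * ‖φ x‖ₑ ^ p ≤
      C * ∫⁻ t in Ioc 0 (2 * r), ENNReal.ofReal (t ^ (s * (p - 1))) *
        ∫⁻ v in ball 0 2, H (x + t • v) ∂ν := by
    intro x hx
    calc ν (ball 0 2 \ ball 0 1) * ‖φ x‖ₑ ^ p
        = ∫⁻ v in ball 0 2 \ ball 0 1, ‖φ x‖ₑ ^ p ∂ν := by
          rw [setLIntegral_const, mul_comm]
      _ ≤ ∫⁻ v in ball 0 2 \ ball 0 1, C * (∫⁻ t in Ioc 0 (2 * r),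
            H (x + t • v) * ENNReal.ofReal (t ^ (s * (p - 1)))) ∂ν := by
          refine setLIntegral_mono' (measurableSet_ball.diff measurableSet_ball) fun v hv => ?_
          have hv1 : 1 ≤ ‖v‖ := by simpa using hv.2
          have hv2 : ‖v‖ₑ ≤ 2 := by
            have : ‖v‖ < 2 := by simpa using hv.1
            rw [← ofReal_norm]
            exact (ENNReal.ofReal_le_ofReal this.le).trans (by simp)
          have h0 : φ (x + (2 * r) • v) = 0 := by
            refine image_eq_zero_of_notMem_tsupport fun hmem => ?_
            have h1 := mem_ball.1 (hsupp hmem)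
            have h2 := mem_ball.1 hx
            have h3 : dist (x + (2 * r) • v) x ≤ dist (x + (2 * r) • v) x0 + dist x x0 :=
              dist_triangle_right _ _ _
            rw [dist_self_add_left, norm_smul, Real.norm_eq_abs, abs_of_pos (by positivity)] at h3
            nlinarith
          refine (enorm_rpow_le_lintegral_fderiv_line hφ x v (by positivity) h0 hp s).trans ?_
          rw [hC]
          gcongr
      _ ≤ ∫⁻ v in ball 0 2, C * (∫⁻ t in Ioc 0 (2 * r),
            H (x + t • v) * ENNReal.ofReal (t ^ (s * (p - 1)))) ∂ν :=
          lintegral_mono_set sdiff_subset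
      _ = _ := by
          have hm : Measurable (Function.uncurry fun (v : E) (t : ℝ) =>
              H (x + t • v) * ENNReal.ofReal (t ^ (s * (p - 1)))) := by
            apply Measurable.mul
            · exact hH.comp (by fun_prop)
            · fun_prop
          have hm' : Measurable fun v => ∫⁻ t in Ioc 0 (2 * r),
              H (x + t • v) * ENNReal.ofReal (t ^ (s * (p - 1))) := hm.lintegral_prod_right'
          rw [lintegral_const_mul _ hm', lintegral_lintegral_swap
            hm.aemeasurable]
          congr 1
          refine lintegral_congr fun t => ?_
          have hmt : Measurable fun v => H (x + t • v) := hH.comp (by fun_prop)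
          rw [lintegral_mul_const _ hmt, mul_comm]
  have hm3 : Measurable fun q : (E × ℝ) × E => H (q.1.1 + q.1.2 • q.2) := hH.comp (by fun_prop)
  have hm2 : Measurable (Function.uncurry fun (x : E) (t : ℝ) =>
      ENNReal.ofReal (t ^ (s * (p - 1))) * ∫⁻ v in ball 0 2, H (x + t • v) ∂ν) := by
    apply Measurable.mul
    · fun_prop
    · exact hm3.lintegral_prod_right' (ν := ν.restrict (ball 0 2))
  have hHsupp : ∀ y, y ∉ ball x0 r → H y = 0 := by
    intro y hy
    have : fderiv ℝ φ y = 0 := by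
      by_contra hne
      exact hy (hsupp (support_fderiv_subset ℝ hne))
    simp only [hHdef, ← ofReal_norm, this, norm_zero, ENNReal.ofReal_zero]
    exact ENNReal.zero_rpow_of_pos (by linarith)
  calc ν (ball 0 2 \ ball 0 1) * ∫⁻ x, ‖φ x‖ₑ ^ p ∂μ
      = ∫⁻ x, ν (ball 0 2 \ ball 0 1) * ‖φ x‖ₑ ^ p ∂μ := by
        rw [lintegral_const_mul]
        exact (hφ.continuous.enorm.measurable).pow_const p
    _ ≤ ∫⁻ x, C * (∫⁻ t in Ioc 0 (2 * r), ENNReal.ofReal (t ^ (s * (p - 1))) *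
          ∫⁻ v in ball 0 2, H (x + t • v) ∂ν) ∂μ := by
        refine lintegral_mono_ae ?_
        filter_upwards [hμ] with x hx using hpt x hx
    _ = C * ∫⁻ t in Ioc 0 (2 * r), ENNReal.ofReal (t ^ (s * (p - 1))) *
          ∫⁻ x, ∫⁻ v in ball 0 2, H (x + t • v) ∂ν ∂μ := by
        have hm' : Measurable fun x => ∫⁻ t in Ioc 0 (2 * r), ENNReal.ofReal (t ^ (s * (p - 1))) *
            ∫⁻ v in ball 0 2, H (x + t • v) ∂ν := hm2.lintegral_prod_right'
        rw [lintegral_const_mul _ hm',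
          lintegral_lintegral_swap hm2.aemeasurable]
        congr 1
        refine lintegral_congr fun t => ?_
        rw [lintegral_const_mul]
        exact (hH.comp (by fun_prop : Measurable fun q : E × E => q.1 + t • q.2)).lintegral_prod_right'
          (ν := ν.restrict (ball 0 2))
    _ ≤ C * ∫⁻ t in Ioc 0 (2 * r), (ENNReal.ofReal (2 ^ lam) *
          ENNReal.ofReal (t ^ (s * (p - 1) - n + lam))) * (M * ∫⁻ y, H y ∂ν) := by
        refine mul_le_mul_right ?_ C
        refine setLIntegral_mono' measurableSet_Ioc fun t ht => ?_
        have ht0 : 0 < t := ht.1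
        have h1 : ∫⁻ y, H y * μ (ball y (t * 2)) ∂ν
            ≤ M * ENNReal.ofReal ((t * 2) ^ lam) * ∫⁻ y, H y ∂ν := by
          rw [← lintegral_const_mul _ hH]
          refine lintegral_mono fun y => ?_
          by_cases hy : y ∈ ball x0 r
          · simp only
            rw [mul_comm]
            gcongr
            exact hgrowth y hy _ (by positivity)
          · simp [hHsupp y hy]
        simp_rw [setLIntegral_ball_comp_add_smul ν hH _ ht0]
        rw [lintegral_const_mul', lintegral_lintegral_ball_swap hH]
        · refine (mul_le_mul_right (mul_le_mul_right h1 _) _).trans (le_of_eq ?_)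
          rw [show s * (p - 1) - n + lam = s * (p - 1) + -n + lam by ring,
            Real.rpow_add ht0, Real.rpow_add ht0, Real.mul_rpow ht0.le zero_le_two,
            ENNReal.ofReal_mul (by positivity), ENNReal.ofReal_mul (by positivity),
            ENNReal.ofReal_mul (by positivity)]
          ring
        · exact ENNReal.ofReal_ne_top
    _ = _ := by
        rw [lintegral_mul_const _ (by fun_prop)]

end NormedSpace

theorem measure_ball_le_of_forall_lt {X : Type*} [PseudoMetricSpace X] [MeasurableSpace X]
    {μ : Measure X} {y : X} {R : ℝ} {C : ℝ≥0∞}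
    (h : ∀ ρ, 0 < ρ → ρ < R → μ (ball y ρ) ≤ C) : μ (ball y R) ≤ C := by
  obtain ⟨u, hu, hlt, htend⟩ := exists_seq_strictMono_tendsto R
  have hU : ball y R ⊆ ⋃ k, ball y (u k) := by
    intro z hz
    obtain ⟨k, hk⟩ := (htend.eventually (lt_mem_nhds (mem_ball.1 hz))).exists
    exact mem_iUnion.2 ⟨k, mem_ball.2 hk⟩
  have hmono : Monotone fun k => ball y (u k) := fun i j hij => ball_subset_ball (hu.monotone hij)
  refine (measure_mono hU).trans ?_
  rw [hmono.measure_iUnion]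
  refine iSup_le fun k => ?_
  rcases le_or_gt (u k) 0 with hk | hk
  · simp [ball_eq_empty.2 hk]
  · exact h _ hk (hlt k)

/-- Morrey's condition on `Ω` bounds the measure `|f| dx` restricted to a ball `B ⊆ Ω`,
on balls of every radius. -/
theorem withDensity_ball_le_of_morrey {E : Type*} [NormedAddCommGroup E] [NormedSpace ℝ E]
    [Nontrivial E] [MeasurableSpace E] [BorelSpace E] {ν : Measure E} {Ω : Set E}
    (hΩ : Bornology.IsBounded Ω) {f : E → ℝ} (hf : IntegrableOn f Ω ν) {N lam : ℝ} (hN : 0 ≤ N)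
    (hlam : 0 ≤ lam)
    (hmorrey : ∀ x ∈ Ω, ∀ ρ : ℝ, 0 < ρ → ρ < diam Ω →
      ∫ y in Ω ∩ ball x ρ, |f y| ∂ν ≤ N * ρ ^ lam)
    {x0 : E} {r : ℝ} (hr : 0 < r) (hB : ball x0 r ⊆ Ω) {y : E} (hy : y ∈ ball x0 r) {ρ : ℝ}
    (hρ : 0 < ρ) :
    (ν.restrict (ball x0 r)).withDensity (fun x => ‖f x‖ₑ) (ball y ρ) ≤
      ENNReal.ofReal N * ENNReal.ofReal (ρ ^ lam) := by
  set μ := (ν.restrict (ball x0 r)).withDensity (fun x => ‖f x‖ₑ) with hμdef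
  have hdiam : 2 * r ≤ diam Ω := by
    rw [← diam_ball_eq x0 hr.le]
    exact diam_mono hB hΩ
  have hsmall : ∀ ρ, 0 < ρ → ρ < 2 * r →
      μ (ball y ρ) ≤ ENNReal.ofReal N * ENNReal.ofReal (ρ ^ lam) := by
    intro ρ hρ hρr
    rw [hμdef, withDensity_apply _ measurableSet_ball, Measure.restrict_restrict measurableSet_ball,
      ← ENNReal.ofReal_mul hN]
    calc ∫⁻ x in ball y ρ ∩ ball x0 r, ‖f x‖ₑ ∂ν
        ≤ ∫⁻ x in Ω ∩ ball y ρ, ‖f x‖ₑ ∂ν :=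
          lintegral_mono_set fun z hz => ⟨hB hz.2, hz.1⟩
      _ = ENNReal.ofReal (∫ x in Ω ∩ ball y ρ, ‖f x‖ ∂ν) :=
          (ofReal_integral_norm_eq_lintegral_enorm (hf.mono_set inter_subset_left)).symm
      _ ≤ _ := ENNReal.ofReal_le_ofReal (hmorrey y (hB hy) ρ hρ (hρr.trans_le hdiam))
  rcases lt_or_ge ρ (2 * r) with h | h
  · exact hsmall ρ hρ h
  · have hae : ∀ᵐ x ∂μ, x ∈ ball x0 r :=
      withDensity_absolutelyContinuous _ _ (ae_restrict_mem measurableSet_ball)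
    have h1 : μ (ball y ρ) ≤ μ (ball y (2 * r)) := by
      refine measure_mono_ae ?_
      filter_upwards [hae] with x hx _
      have := dist_triangle_right x y x0
      have := mem_ball.1 hx
      have := mem_ball.1 hy
      exact mem_ball.2 (by linarith)
    refine h1.trans (measure_ball_le_of_forall_lt fun ρ' h0 h2 => (hsmall ρ' h0 h2).trans ?_)
    gcongr
    exact h2.le.trans h

/-- Fefferman–Phong type inequality with Morrey data: for `1 ≤ p < n`,
`n - p < λ < n` there is `c = c(p,λ,n) > 0` such that for every bounded domain
`Ω`, every `f ∈ L^{1,λ}(Ω)` (with Morrey constant `N`), every ball `B ⊆ Ω` of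
radius `r` and every test function `φ ∈ C_c^∞(B) ⊆ W^{1,p}_0(B)`,
`∫_B |f||φ|^p ≤ c r^{λ-n+p} N ∫_B |Dφ|^p`. -/
theorem fefferman_phong_morrey
    (n : ℕ) (p lam : ℝ) (hp : 1 ≤ p) (hpn : p < n)
    (hl1 : (n : ℝ) - p < lam) (hl2 : lam < n) :
    ∃ c > (0 : ℝ), ∀ (Ω : Set (EuclideanSpace ℝ (Fin n))), IsOpen Ω →
      Bornology.IsBounded Ω →
      ∀ (f : EuclideanSpace ℝ (Fin n) → ℝ) (N : ℝ), 0 ≤ N → IntegrableOn f Ω →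
      (∀ x ∈ Ω, ∀ ρ : ℝ, 0 < ρ → ρ < Metric.diam Ω →
        ∫ y in Ω ∩ Metric.ball x ρ, |f y| ≤ N * ρ ^ lam) →
      ∀ (x0 : EuclideanSpace ℝ (Fin n)) (r : ℝ), 0 < r → Metric.ball x0 r ⊆ Ω →
      ∀ φ : EuclideanSpace ℝ (Fin n) → ℝ, ContDiff ℝ (⊤ : ℕ∞) φ → HasCompactSupport φ →
        tsupport φ ⊆ Metric.ball x0 r →
      ∫ x in Metric.ball x0 r, |f x| * |φ x| ^ p
        ≤ c * r ^ (lam - n + p) * N * ∫ x in Metric.ball x0 r, ‖fderiv ℝ φ x‖ ^ p := by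
  have hp0 : 0 < p := by linarith
  have hn : 0 < n := by
    have : (0 : ℝ) < n := by linarith
    exact_mod_cast this
  have : Nonempty (Fin n) := ⟨⟨0, hn⟩⟩
  set E := EuclideanSpace ℝ (Fin n)
  have hfin : Module.finrank ℝ E = n := finrank_euclideanSpace_fin
  set S : Set E := ball 0 2 \ ball 0 1 with hS
  have hσtop : volume S ≠ ∞ := ((measure_mono sdiff_subset).trans_lt measure_ball_lt_top).ne
  have hσ0 : volume S ≠ 0 := by
    obtain ⟨v, hv⟩ := exists_norm_eq E (show (0 : ℝ) ≤ 3 / 2 by norm_num)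
    have hsub : ball v (1 / 2) ⊆ S := by
      intro z hz
      have h1 := mem_ball_iff_norm.1 hz
      have h2 := norm_sub_norm_le z v
      have h3 := norm_sub_norm_le v z
      rw [norm_sub_rev] at h3
      refine ⟨mem_ball_zero_iff.2 (by linarith), fun h => ?_⟩
      have := mem_ball_zero_iff.1 h
      linarith
    exact ((measure_ball_pos volume v (by norm_num)).trans_le (measure_mono hsub)).ne'
  set σ := (volume S).toReal with hσ
  have hσpos : 0 < σ := ENNReal.toReal_pos hσ0 hσtop
  obtain ⟨e, he, b, hb, heb⟩ : ∃ e > 0, ∃ b > 0, e * (p - 1) + b = lam - n + p := by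
    refine ⟨(lam - n + p) / (2 * p), div_pos (by linarith) (by linarith),
      (lam - n + p) * (p + 1) / (2 * p),
      div_pos (mul_pos (by linarith) (by linarith)) (by linarith), ?_⟩
    field_simp
    ring
  refine ⟨2 ^ p * (1 / e) ^ (p - 1) * (2 ^ lam / b) * 2 ^ (lam - n + p) / σ, by positivity, ?_⟩
  intro Ω _ hΩ f N hN hf hmorrey x0 r hr hB φ hφ hφc hsupp
  have hφ1 : ContDiff ℝ 1 φ := hφ.of_le (by exact_mod_cast le_top)
  have hfd : Continuous (fderiv ℝ φ) := hφ1.continuous_fderiv one_ne_zero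
  set L := ∫ x in ball x0 r, |f x| * |φ x| ^ p with hL
  set R := ∫ x in ball x0 r, ‖fderiv ℝ φ x‖ ^ p with hR
  have hR0 : 0 ≤ R := by positivity
  have hfm : AEMeasurable (fun x => ‖f x‖ₑ) (volume.restrict (ball x0 r)) :=
    (hf.mono_set hB).aestronglyMeasurable.enorm
  have hLle : ENNReal.ofReal L ≤
      ∫⁻ x, ‖φ x‖ₑ ^ p ∂((volume.restrict (ball x0 r)).withDensity fun x => ‖f x‖ₑ) := by
    rw [lintegral_withDensity_eq_lintegral_mul₀ hfm
      (hφ.continuous.enorm.measurable.pow_const p).aemeasurable]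
    refine (Real.ofReal_le_enorm _).trans ((enorm_integral_le_lintegral_enorm _).trans_eq ?_)
    refine lintegral_congr fun x => ?_
    simp [enorm_mul, Real.enorm_rpow_of_nonneg (abs_nonneg _) hp0.le]
  have hReq : ∫⁻ y, ‖fderiv ℝ φ y‖ₑ ^ p = ENNReal.ofReal R := by
    have hzero : ∀ x, fderiv ℝ φ x = 0 → ‖fderiv ℝ φ x‖ ^ p = 0 := by
      intro x hx
      rw [hx, norm_zero, Real.zero_rpow hp0.ne']
    rw [hR, setIntegral_eq_integral_of_forall_compl_eq_zero, ofReal_integral_eq_lintegral_ofReal]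
    · refine lintegral_congr fun x => ?_
      rw [← ofReal_norm, ENNReal.ofReal_rpow_of_nonneg (norm_nonneg _) hp0.le]
    · refine Continuous.integrable_of_hasCompactSupport
        (hfd.norm.rpow_const fun _ => Or.inr hp0.le) ?_
      exact (hφc.fderiv ℝ).mono' fun x hx => subset_tsupport _ fun h => hx (hzero x h)
    · exact Filter.Eventually.of_forall fun x => by positivity
    · intro x hx
      refine hzero x ?_
      by_contra hne
      exact hx (hsupp (support_fderiv_subset ℝ hne))
  have key := lintegral_enorm_rpow_le_of_growth (volume : Measure E) hφ1 hr hsupp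
    (withDensity_absolutelyContinuous _ _ (ae_restrict_mem measurableSet_ball))
    (fun y hy ρ hρ => withDensity_ball_le_of_morrey hΩ hf hN (by linarith) hmorrey hr hB hy hρ)
    hp (1 - e)
  have hexp : (1 - e) * (p - 1) - n + lam = b - 1 := by linarith
  rw [hReq, hfin, hexp, lintegral_const_mul' _ _ ENNReal.ofReal_ne_top,
    lintegral_Ioc_rpow (by positivity) (by linarith),
    lintegral_Ioc_rpow (by positivity) (by linarith), show -(1 - e) + 1 = e by ring,
    sub_add_cancel] at key
  have hreal := (mul_le_mul_right hLle (volume S)).trans key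
  rw [← ENNReal.ofReal_toReal hσtop, ← hσ, ← ENNReal.ofReal_mul hσpos.le,
    show (2 : ℝ≥0∞) = ENNReal.ofReal 2 by simp, ENNReal.ofReal_rpow_of_pos two_pos,
    ENNReal.ofReal_rpow_of_nonneg (by positivity) (by linarith),
    ← ENNReal.ofReal_mul (by positivity), ← ENNReal.ofReal_mul (by positivity),
    ← ENNReal.ofReal_mul hN, ← ENNReal.ofReal_mul (by positivity),
    ← ENNReal.ofReal_mul (by positivity), ENNReal.ofReal_le_ofReal_iff (by positivity)] at hreal
  have hpow : ((2 * r) ^ e / e) ^ (p - 1) * (2 * r) ^ b =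
      (1 / e) ^ (p - 1) * 2 ^ (lam - n + p) * r ^ (lam - n + p) := by
    have h2r : 0 < 2 * r := by positivity
    rw [mul_assoc, ← Real.mul_rpow zero_le_two hr.le, ← heb, Real.rpow_add h2r, Real.rpow_mul h2r.le,
      div_eq_mul_one_div, Real.mul_rpow (by positivity) (by positivity)]
    ring
  calc L = σ * L / σ := by field_simp
    _ ≤ _ := div_le_div_of_nonneg_right hreal hσpos.le
    _ = 2 ^ p * (((2 * r) ^ e / e) ^ (p - 1) * (2 * r) ^ b) * (2 ^ lam / b) * N * R / σ := by ring
    _ = _ := by rw [hpow]; ring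
end

section
/- Local boundedness of the data functional: if 1 < p < n, n−1 < λ < n, f ∈ L^{1,λ}(Ω), and B ⊂ Ω is a ball of radius r, then for every φ ∈ C_0^∞(B), ∫_B |f||φ| dx ≤ c · r^{λ+1−n/p} · ‖f‖_{L^{1,λ}(Ω)} · ‖φ‖_{W^{1,p}(Ω)}, where c depends only on p, n, λ; moreover λ + 1 − n/p > 0. -/
open MeasureTheory Metric Set

section AddHaar

variable {E : Type*} [NormedAddCommGroup E] [NormedSpace ℝ E] [FiniteDimensional ℝ E]
  [MeasurableSpace E] [BorelSpace E] (μ : Measure E) [μ.IsAddHaarMeasure]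

open Module in
theorem setLIntegral_ball_comp_sub_smul {F : E → ENNReal} (hF : Measurable F) (y : E) {t : ℝ}
    (ht : 0 < t) :
    ∫⁻ z in ball 0 1, F (y - t • z) ∂μ =
      ENNReal.ofReal (t ^ finrank ℝ E)⁻¹ * ∫⁻ w in ball y t, F w ∂μ := by
  have hG : Measurable fun w => (ball y t).indicator F (y - w) :=
    (hF.indicator measurableSet_ball).comp (measurable_const.sub measurable_id)
  calc ∫⁻ z in ball 0 1, F (y - t • z) ∂μ
      = ∫⁻ z, (ball y t).indicator F (y - t • z) ∂μ := by
        rw [← lintegral_indicator measurableSet_ball]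
        refine lintegral_congr fun z => ?_
        have : z ∈ ball (0 : E) 1 ↔ y - t • z ∈ ball y t := by
          rw [mem_ball_zero_iff, mem_ball_iff_norm, sub_sub_cancel_left, norm_neg, norm_smul,
            Real.norm_of_nonneg ht.le, mul_lt_iff_lt_one_right ht]
        by_cases hz : z ∈ ball (0 : E) 1
        · rw [indicator_of_mem hz, indicator_of_mem (this.1 hz)]
        · rw [indicator_of_notMem hz, indicator_of_notMem (mt this.2 hz)]
    _ = ∫⁻ w, (ball y t).indicator F (y - w) ∂(Measure.map (t • ·) μ) :=
        (lintegral_map hG (measurable_const_smul t)).symm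
    _ = _ := by
        rw [Measure.map_addHaar_smul μ ht.ne', lintegral_smul_measure, smul_eq_mul,
          lintegral_sub_left_eq_self (μ := μ) (fun w => (ball y t).indicator F w) y,
          lintegral_indicator measurableSet_ball, abs_of_pos (by positivity)]

open Module in
/-- If `u` is dominated along every direction `z ∈ A` by the line integral of `D`, then the
integral of `F * u` is controlled by `∫ D` and the growth of `F` on small balls. -/
theorem lintegral_mul_mul_measure_le {F D u : E → ENNReal} {K : ℝ → ENNReal} {A : Set E} {T : ℝ}
    (hF : Measurable F) (hD : Measurable D) (hKm : Measurable K) (hA : MeasurableSet A)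
    (hA1 : A ⊆ ball 0 1)
    (hK : ∀ t ∈ Ioc 0 T, ∀ y, D y ≠ 0 → ∫⁻ w in ball y t, F w ∂μ ≤ K t)
    (hu : ∀ x, F x ≠ 0 → ∀ z ∈ A, u x ≤ ∫⁻ t in Ioc 0 T, D (x + t • z)) :
    (∫⁻ x, F x * u x ∂μ) * μ A ≤
      (∫⁻ t in Ioc 0 T, ENNReal.ofReal (t ^ finrank ℝ E)⁻¹ * K t) * ∫⁻ y, D y ∂μ := by
  have hDm : Measurable fun q : (E × ℝ) × E => D (q.1.1 + q.1.2 • q.2) :=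
    hD.comp ((by fun_prop : Continuous fun q : (E × ℝ) × E => q.1.1 + q.1.2 • q.2).measurable)
  have hpt (x : E) : F x * u x * μ A ≤
      F x * ∫⁻ t in Ioc 0 T, ∫⁻ z in A, D (x + t • z) ∂μ := by
    by_cases hx : F x = 0
    · simp [hx]
    rw [mul_assoc]
    gcongr
    rw [lintegral_lintegral_swap]
    · rw [← setLIntegral_const]
      exact setLIntegral_mono' hA fun z hz => hu x hx z hz
    · exact (hD.comp ((by fun_prop : Continuous fun q : ℝ × E =>
        x + q.1 • q.2).measurable)).aemeasurable
  have hslice (t : ℝ) (ht : t ∈ Ioc 0 T) :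
      ∫⁻ x, F x * ∫⁻ z in A, D (x + t • z) ∂μ ∂μ ≤
        ENNReal.ofReal (t ^ finrank ℝ E)⁻¹ * K t * ∫⁻ y, D y ∂μ := by
    calc ∫⁻ x, F x * ∫⁻ z in A, D (x + t • z) ∂μ ∂μ
        = ∫⁻ x, ∫⁻ z in A, F x * D (x + t • z) ∂μ ∂μ := by
          refine lintegral_congr fun x => (lintegral_const_mul _ ?_).symm
          exact hD.comp ((by fun_prop : Continuous fun z : E => x + t • z).measurable)
      _ = ∫⁻ z in A, ∫⁻ x, F x * D (x + t • z) ∂μ ∂μ := by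
          rw [lintegral_lintegral_swap]
          exact ((hF.comp measurable_fst).mul (hD.comp ((by fun_prop : Continuous fun q : E × E =>
            q.1 + t • q.2).measurable))).aemeasurable
      _ = ∫⁻ z in A, ∫⁻ y, F (y - t • z) * D y ∂μ ∂μ := by
          refine lintegral_congr fun z => ?_
          rw [← lintegral_add_right_eq_self (μ := μ) (fun y => F (y - t • z) * D y) (t • z)]
          simp
      _ = ∫⁻ y, ∫⁻ z in A, F (y - t • z) * D y ∂μ ∂μ := by
          rw [lintegral_lintegral_swap]
          exact ((hF.comp ((by fun_prop : Continuous fun q : E × E =>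
            q.2 - t • q.1).measurable)).mul (hD.comp measurable_snd)).aemeasurable
      _ ≤ ∫⁻ y, ENNReal.ofReal (t ^ finrank ℝ E)⁻¹ * K t * D y ∂μ := by
          refine lintegral_mono fun y => ?_
          have hm : Measurable fun z : E => F (y - t • z) :=
            hF.comp ((by fun_prop : Continuous fun z : E => y - t • z).measurable)
          rw [lintegral_mul_const _ hm]
          by_cases hy : D y = 0
          · simp [hy]
          gcongr
          refine (lintegral_mono_set hA1).trans ?_
          rw [setLIntegral_ball_comp_sub_smul μ hF y ht.1]
          gcongr
          exact hK t ht y hy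
      _ = _ := lintegral_const_mul _ hD
  calc (∫⁻ x, F x * u x ∂μ) * μ A ≤ ∫⁻ x, F x * u x * μ A ∂μ := lintegral_mul_const_le _ _
    _ ≤ ∫⁻ x, F x * (∫⁻ t in Ioc 0 T, ∫⁻ z in A, D (x + t • z) ∂μ) ∂μ := lintegral_mono hpt
    _ = ∫⁻ x, (∫⁻ t in Ioc 0 T, F x * ∫⁻ z in A, D (x + t • z) ∂μ) ∂μ := by
        refine lintegral_congr fun x => (lintegral_const_mul _ ?_).symm
        exact (hDm.lintegral_prod_right' (ν := μ.restrict A)).comp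
          (measurable_const.prodMk measurable_id : Measurable fun t : ℝ => (x, t))
    _ = ∫⁻ t in Ioc 0 T, ∫⁻ x, F x * ∫⁻ z in A, D (x + t • z) ∂μ ∂μ := by
        rw [lintegral_lintegral_swap]
        exact ((hF.comp measurable_fst).mul
          (hDm.lintegral_prod_right' (ν := μ.restrict A))).aemeasurable
    _ ≤ ∫⁻ t in Ioc 0 T, ENNReal.ofReal (t ^ finrank ℝ E)⁻¹ * K t * ∫⁻ y, D y ∂μ :=
        setLIntegral_mono' measurableSet_Ioc hslice
    _ = _ := lintegral_mul_const _ (by fun_prop)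

end AddHaar

theorem enorm_le_setLIntegral_enorm_fderiv {E : Type*} [NormedAddCommGroup E] [NormedSpace ℝ E]
    {φ : E → ℝ} (hφ : ContDiff ℝ 1 φ) {x z : E} {T : ℝ} (hT : 0 ≤ T) (hz : ‖z‖ ≤ 1)
    (h0 : φ (x + T • z) = 0) :
    ‖φ x‖ₑ ≤ ∫⁻ t in Ioc 0 T, ‖fderiv ℝ φ (x + t • z)‖ₑ := by
  have hline : Continuous fun t : ℝ => x + t • z := by fun_prop
  have hd : Continuous fun t : ℝ => fderiv ℝ φ (x + t • z) z :=
    ((hφ.continuous_fderiv one_ne_zero).comp hline).clm_apply continuous_const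
  have hderiv (t : ℝ) : HasDerivAt (fun t : ℝ => φ (x + t • z)) (fderiv ℝ φ (x + t • z) z) t := by
    have h1 : HasDerivAt (fun t : ℝ => x + t • z) z t := by
      simpa using ((hasDerivAt_id t).smul_const z).const_add x
    exact ((hφ.differentiable one_ne_zero _).hasFDerivAt).comp_hasDerivAt t h1
  have hftc := intervalIntegral.integral_eq_sub_of_hasDerivAt (a := 0) (b := T)
    (fun t _ => hderiv t) (hd.intervalIntegrable _ _)
  rw [intervalIntegral.integral_of_le hT, h0] at hftc
  simp only [zero_smul, add_zero, zero_sub] at hftc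
  rw [← enorm_neg, ← hftc]
  refine (enorm_integral_le_lintegral_enorm _).trans (lintegral_mono fun t => ?_)
  refine (ContinuousLinearMap.le_opENorm _ _).trans ?_
  refine mul_le_of_le_one_right' ?_
  rw [← ofReal_norm]
  exact ENNReal.ofReal_le_one.2 hz

theorem setLIntegral_Ioc_ofReal_rpow {s T : ℝ} (hs : 0 < s) (hT : 0 ≤ T) :
    ∫⁻ t in Ioc 0 T, ENNReal.ofReal (t ^ (s - 1)) = ENNReal.ofReal (T ^ s / s) := by
  rw [← ofReal_integral_eq_lintegral_ofReal, ← intervalIntegral.integral_of_le hT,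
    integral_rpow (Or.inl (by linarith)), sub_add_cancel, Real.zero_rpow hs.ne', sub_zero]
  · exact (intervalIntegrable_iff_integrableOn_Ioc_of_le hT).1
      (intervalIntegral.intervalIntegrable_rpow' (by linarith))
  · filter_upwards [ae_restrict_mem measurableSet_Ioc] with t ht
    exact Real.rpow_nonneg ht.1.le _

theorem setLIntegral_enorm_le_rpow_mul {α E : Type*} [MeasurableSpace α] {μ : Measure α}
    [NormedAddCommGroup E] {g : α → E} {s : Set α} {p : ℝ} (hp : 1 ≤ p)
    (hg : AEStronglyMeasurable g (μ.restrict s)) :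
    ∫⁻ x in s, ‖g x‖ₑ ∂μ ≤ (∫⁻ x in s, ‖g x‖ₑ ^ p ∂μ) ^ (1 / p) * μ s ^ (1 - 1 / p) := by
  simpa [eLpNorm'] using eLpNorm'_le_eLpNorm'_mul_rpow_measure_univ one_pos hp hg

/-- A Morrey bound at radii below the diameter of `Ω` extends to all radii, once `f` is restricted
to a ball contained in `Ω`. -/
theorem setLIntegral_ball_inter_ball_le_of_morrey {E : Type*} [NormedAddCommGroup E]
    [NormedSpace ℝ E] [Nontrivial E] [MeasurableSpace E] [OpensMeasurableSpace E] {μ : Measure E}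
    {Ω : Set E} {f : E → ℝ} {N lam r : ℝ} {x0 : E} (hΩ : Bornology.IsBounded Ω)
    (hN : 0 ≤ N) (hlam : 0 ≤ lam) (hf : IntegrableOn f Ω μ)
    (hM : ∀ x ∈ Ω, ∀ ρ : ℝ, 0 < ρ → ρ < diam Ω → ∫ y in Ω ∩ ball x ρ, |f y| ∂μ ≤ N * ρ ^ lam)
    (hr : 0 < r) (hB : ball x0 r ⊆ Ω) {y : E} (hy : y ∈ ball x0 r) {t : ℝ} (ht : 0 < t) :
    ∫⁻ w in ball y t ∩ ball x0 r, ‖f w‖ₑ ∂μ ≤ ENNReal.ofReal (N * t ^ lam) := by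
  have hdiam : r < diam Ω := by
    have := diam_mono hB hΩ
    rw [diam_ball_eq x0 hr.le] at this
    linarith
  have key : ∀ x ∈ Ω, ∀ ρ : ℝ, 0 < ρ → ρ < diam Ω →
      ∫⁻ w in Ω ∩ ball x ρ, ‖f w‖ₑ ∂μ ≤ ENNReal.ofReal (N * ρ ^ lam) := by
    intro x hx ρ hρ hρ'
    rw [← ofReal_integral_norm_eq_lintegral_enorm (hf.mono_set inter_subset_left)]
    exact ENNReal.ofReal_le_ofReal (hM x hx ρ hρ hρ')
  rcases lt_or_ge t r with htr | htr
  · exact (lintegral_mono_set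
      fun w (hw : w ∈ ball y t ∩ ball x0 r) => mem_inter (hB hw.2) hw.1).trans
      (key y (hB hy) t ht (htr.trans hdiam))
  · refine (lintegral_mono_set
      fun w (hw : w ∈ ball y t ∩ ball x0 r) => mem_inter (hB hw.2) hw.2).trans
      ((key x0 (hB (mem_ball_self hr)) r hr hdiam).trans ?_)
    gcongr

/-- The `L¹` pairing of a Morrey function with a test function on a ball, bounded by the
`L¹` norm of the gradient. -/
theorem setLIntegral_enorm_mul_le_of_morrey {E : Type*} [NormedAddCommGroup E]
    [NormedSpace ℝ E] [FiniteDimensional ℝ E] [Nontrivial E] [MeasurableSpace E] [BorelSpace E]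
    (μ : Measure E) [μ.IsAddHaarMeasure] {Ω : Set E} {f φ : E → ℝ} {N lam r : ℝ} {x0 e : E}
    (hΩ : Bornology.IsBounded Ω) (hN : 0 ≤ N) (hlam : 0 ≤ lam)
    (hlam' : (Module.finrank ℝ E : ℝ) - 1 < lam) (hf : IntegrableOn f Ω μ)
    (hM : ∀ x ∈ Ω, ∀ ρ : ℝ, 0 < ρ → ρ < diam Ω → ∫ y in Ω ∩ ball x ρ, |f y| ∂μ ≤ N * ρ ^ lam)
    (hr : 0 < r) (hB : ball x0 r ⊆ Ω) (hφ : ContDiff ℝ 1 φ) (hφs : tsupport φ ⊆ ball x0 r)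
    (he : ‖e‖ = 3 / 4) :
    (∫⁻ x in ball x0 r, ‖f x‖ₑ * ‖φ x‖ₑ ∂μ) * μ (ball e (1 / 4)) ≤
      ENNReal.ofReal (N * ((4 * r) ^ (lam - Module.finrank ℝ E + 1) /
        (lam - Module.finrank ℝ E + 1))) * ∫⁻ y in ball x0 r, ‖fderiv ℝ φ y‖ₑ ∂μ := by
  set B := ball x0 r
  set s := lam - Module.finrank ℝ E + 1 with hs
  have hs0 : 0 < s := by linarith
  have hfB : AEStronglyMeasurable f (μ.restrict B) := (hf.mono_set hB).aestronglyMeasurable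
  set g := hfB.mk f
  have hfg : f =ᵐ[μ.restrict B] g := hfB.ae_eq_mk
  have hgm : Measurable fun x => ‖g x‖ₑ := hfB.stronglyMeasurable_mk.enorm
  have hsupp {y : E} (hy : ‖fderiv ℝ φ y‖ₑ ≠ 0) : y ∈ B :=
    hφs (support_fderiv_subset ℝ fun h => hy (by simp [← ofReal_norm, h]))
  have hnorm {z : E} (hz : z ∈ ball e (1 / 4)) : 1 / 2 ≤ ‖z‖ ∧ ‖z‖ < 1 := by
    rw [mem_ball_iff_norm] at hz
    have h1 := norm_sub_norm_le z e
    have h2 := norm_sub_norm_le e z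
    rw [norm_sub_rev e z] at h2
    constructor <;> linarith
  have main := lintegral_mul_mul_measure_le μ (F := B.indicator fun x => ‖g x‖ₑ)
    (D := fun y => ‖fderiv ℝ φ y‖ₑ) (u := fun x => ‖φ x‖ₑ)
    (K := fun t => ENNReal.ofReal (N * t ^ lam)) (A := ball e (1 / 4)) (T := 4 * r)
    (hgm.indicator measurableSet_ball) (hφ.continuous_fderiv one_ne_zero).enorm.measurable
    (by fun_prop) measurableSet_ball (fun z hz => mem_ball_zero_iff.2 (hnorm hz).2) ?_ ?_
  · have hl : ∫⁻ x, B.indicator (fun x => ‖g x‖ₑ) x * ‖φ x‖ₑ ∂μ =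
        ∫⁻ x in B, ‖f x‖ₑ * ‖φ x‖ₑ ∂μ := by
      simp_rw [← indicator_mul_left B (fun x => ‖g x‖ₑ) fun x => ‖φ x‖ₑ]
      rw [lintegral_indicator measurableSet_ball]
      refine lintegral_congr_ae ?_
      filter_upwards [hfg] with x hx
      rw [hx]
    have hD : ∫⁻ y, ‖fderiv ℝ φ y‖ₑ ∂μ = ∫⁻ y in B, ‖fderiv ℝ φ y‖ₑ ∂μ :=
      (setLIntegral_eq_of_support_subset fun y hy => hsupp hy).symm
    have ht : ∫⁻ t in Ioc 0 (4 * r), ENNReal.ofReal (t ^ Module.finrank ℝ E)⁻¹ *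
        ENNReal.ofReal (N * t ^ lam) = ENNReal.ofReal (N * ((4 * r) ^ s / s)) := by
      rw [ENNReal.ofReal_mul hN, ← setLIntegral_Ioc_ofReal_rpow hs0 (by positivity),
        ← lintegral_const_mul _ (by fun_prop)]
      refine setLIntegral_congr_fun measurableSet_Ioc fun t ht => ?_
      have ht0 : 0 < t := ht.1
      rw [← ENNReal.ofReal_mul (by positivity), ← ENNReal.ofReal_mul hN]
      congr 1
      rw [hs, add_sub_cancel_right, Real.rpow_sub ht0, Real.rpow_natCast]
      ring
    rw [hl, hD, ht] at main
    exact main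
  · intro t ht y hy
    have hyB : y ∈ B := hsupp hy
    rw [setLIntegral_indicator measurableSet_ball, inter_comm]
    refine (lintegral_congr_ae ?_).trans_le
      (setLIntegral_ball_inter_ball_le_of_morrey hΩ hN hlam hf hM hr hB hyB ht.1)
    filter_upwards [ae_restrict_of_ae_restrict_of_subset inter_subset_right hfg] with x hx
    rw [hx]
  · intro x hx z hz
    have hxB : x ∈ B := mem_of_indicator_ne_zero hx
    refine enorm_le_setLIntegral_enorm_fderiv hφ (by positivity) (hnorm hz).2.le ?_
    refine image_eq_zero_of_notMem_tsupport fun h => ?_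
    have h1 := mem_ball_iff_norm.1 (hφs h)
    have h2 := mem_ball_iff_norm.1 hxB
    have h3 : ‖(4 * r) • z‖ = 4 * r * ‖z‖ := by
      rw [norm_smul, Real.norm_of_nonneg (by positivity)]
    have h4 : ‖(4 * r) • z‖ ≤ ‖x + (4 * r) • z - x0‖ + ‖x - x0‖ := by
      have : (4 * r) • z = (x + (4 * r) • z - x0) - (x - x0) := by abel
      exact (congrArg norm this).trans_le (norm_sub_le _ _)
    nlinarith [(hnorm hz).1]

/-- Local boundedness of the data functional: for `1 < p < n`, `n-1 < λ < n`,
one has `λ + 1 - n/p > 0` and there is `c = c(p,n,λ) > 0` such that for any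
`f ∈ L^{1,λ}(Ω)` (Morrey constant `N`), any ball `B ⊆ Ω` of radius `r` and any
`φ ∈ C_c^∞(B)`, `∫_B |f||φ| ≤ c r^{λ+1-n/p} N ‖φ‖_{W^{1,p}(Ω)}`. -/
theorem data_functional_local_bound
    (n : ℕ) (p lam : ℝ) (hp : 1 < p) (hpn : p < n)
    (hl1 : (n : ℝ) - 1 < lam) (hl2 : lam < n) :
    0 < lam + 1 - (n : ℝ) / p ∧
    ∃ c > (0 : ℝ), ∀ (Ω : Set (EuclideanSpace ℝ (Fin n))), IsOpen Ω →
      Bornology.IsBounded Ω →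
      ∀ (f : EuclideanSpace ℝ (Fin n) → ℝ) (N : ℝ), 0 ≤ N → IntegrableOn f Ω →
      (∀ x ∈ Ω, ∀ ρ : ℝ, 0 < ρ → ρ < Metric.diam Ω →
        ∫ y in Ω ∩ Metric.ball x ρ, |f y| ≤ N * ρ ^ lam) →
      ∀ (x0 : EuclideanSpace ℝ (Fin n)) (r : ℝ), 0 < r → Metric.ball x0 r ⊆ Ω →
      ∀ φ : EuclideanSpace ℝ (Fin n) → ℝ, ContDiff ℝ (⊤ : ℕ∞) φ → HasCompactSupport φ →
        tsupport φ ⊆ Metric.ball x0 r →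
      ∫ x in Metric.ball x0 r, |f x| * |φ x|
        ≤ c * r ^ (lam + 1 - (n : ℝ) / p) * N *
          (∫ x in Ω, (|φ x| ^ p + ‖fderiv ℝ φ x‖ ^ p)) ^ (1 / p) := by
  have hp0 : 0 < p := by linarith
  have hn0 : (0 : ℝ) < n := by linarith
  refine ⟨by linarith [div_lt_self hn0 hp], ?_⟩
  have : Nonempty (Fin n) := Fin.pos_iff_nonempty.1 (by exact_mod_cast hn0)
  obtain ⟨e, he⟩ := exists_norm_eq (EuclideanSpace ℝ (Fin n)) (by norm_num : (0 : ℝ) ≤ 3 / 4)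
  set s := lam - n + 1 with hs
  have hs0 : 0 < s := by linarith
  set a := volume.real (ball e (1 / 4)) with ha
  set b := volume.real (ball (0 : EuclideanSpace ℝ (Fin n)) 1) with hb
  have ha0 : 0 < a :=
    ENNReal.toReal_pos (measure_ball_pos volume e (by norm_num)).ne' measure_ball_lt_top.ne
  have hb0 : 0 < b :=
    ENNReal.toReal_pos (measure_ball_pos volume 0 one_pos).ne' measure_ball_lt_top.ne
  refine ⟨4 ^ s / s * b ^ (1 - 1 / p) / a, by positivity, ?_⟩
  intro Ω hΩo hΩb f N hN hf hM x0 r hr hB φ hφ hφc hφs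
  have hφ1 : ContDiff ℝ 1 φ := hφ.of_le (by exact_mod_cast le_top)
  have hDc : Continuous (fderiv ℝ φ) := hφ1.continuous_fderiv one_ne_zero
  have hDp : Integrable fun x => ‖fderiv ℝ φ x‖ ^ p :=
    (hDc.norm.rpow_const fun _ => Or.inr hp0.le).integrable_of_hasCompactSupport
      ((hφc.fderiv ℝ).comp_left (g := fun y => ‖y‖ ^ p) (by simp [hp0.ne']))
  have hφp : Integrable fun x => |φ x| ^ p :=
    (hφ1.continuous.abs.rpow_const fun _ => Or.inr hp0.le).integrable_of_hasCompactSupport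
      (hφc.comp_left (g := fun y => |y| ^ p) (by simp [hp0.ne']))
  set I := ∫ x in Ω, (|φ x| ^ p + ‖fderiv ℝ φ x‖ ^ p) with hI
  have hI0 : 0 ≤ I := integral_nonneg fun x => by positivity
  have hDI : ∫⁻ x in ball x0 r, ‖fderiv ℝ φ x‖ₑ ^ p ≤ ENNReal.ofReal I := by
    have h1 : ∫ x in ball x0 r, ‖fderiv ℝ φ x‖ ^ p ≤ I :=
      (setIntegral_mono_set hDp.integrableOn (ae_of_all _ fun x => by positivity)
        hB.eventuallyLE).trans
        (integral_mono hDp.integrableOn (hφp.add hDp).integrableOn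
          fun x => le_add_of_nonneg_left (by positivity))
    refine le_trans (le_of_eq ?_) (ENNReal.ofReal_le_ofReal h1)
    rw [ofReal_integral_eq_lintegral_ofReal hDp.integrableOn (ae_of_all _ fun x => by positivity)]
    refine lintegral_congr fun x => ?_
    rw [← ENNReal.ofReal_rpow_of_nonneg (norm_nonneg _) hp0.le, ofReal_norm]
  have hvol : volume (ball x0 r) = ENNReal.ofReal (r ^ n * b) := by
    rw [Measure.addHaar_ball_of_pos volume x0 hr, finrank_euclideanSpace_fin,
      ENNReal.ofReal_mul (by positivity), hb, ofReal_measureReal]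
  have hp1 : 0 ≤ 1 - 1 / p := sub_nonneg.2 ((div_le_one hp0).2 hp.le)
  have hgrad : ∫⁻ x in ball x0 r, ‖fderiv ℝ φ x‖ₑ ≤
      ENNReal.ofReal (I ^ (1 / p) * (r ^ n * b) ^ (1 - 1 / p)) := by
    refine (setLIntegral_enorm_le_rpow_mul hp.le hDc.aestronglyMeasurable).trans ?_
    rw [hvol, ENNReal.ofReal_mul (p := I ^ (1 / p)) (by positivity),
      ← ENNReal.ofReal_rpow_of_nonneg hI0 (by positivity),
      ← ENNReal.ofReal_rpow_of_nonneg (by positivity) hp1]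
    gcongr
  have hmain := setLIntegral_enorm_mul_le_of_morrey volume hΩb hN (by linarith) (by simpa)
    hf hM hr hB hφ1 hφs he
  rw [finrank_euclideanSpace_fin, ← hs, ← ofReal_measureReal (s := ball e (1 / 4))] at hmain
  have hpair : ENNReal.ofReal ((∫ x in ball x0 r, |f x| * |φ x|) * a) ≤
      ENNReal.ofReal (N * ((4 * r) ^ s / s) * (I ^ (1 / p) * (r ^ n * b) ^ (1 - 1 / p))) := by
    rw [ENNReal.ofReal_mul (integral_nonneg fun x => by positivity),
      ENNReal.ofReal_mul (by positivity)]
    refine le_trans ?_ (hmain.trans (by gcongr))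
    gcongr
    rw [← Real.enorm_of_nonneg (integral_nonneg fun x => by positivity)]
    refine (enorm_integral_le_lintegral_enorm _).trans (lintegral_mono fun x => ?_)
    simp [enorm_mul]
  have hfin := (ENNReal.ofReal_le_ofReal_iff (by positivity)).1 hpair
  refine ((le_div_iff₀ ha0).2 hfin).trans (le_of_eq ?_)
  have hexp : r ^ (lam + 1 - (n : ℝ) / p) = r ^ s * (r ^ n) ^ (1 - 1 / p) := by
    rw [← Real.rpow_natCast, ← Real.rpow_mul hr.le, ← Real.rpow_add hr, hs]
    congr 1
    field_simp
    ring
  rw [hexp, Real.mul_rpow (by norm_num) hr.le, Real.mul_rpow (by positivity) hb0.le]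
  ring
end

section
/- Sharpness of the Morrey exponent: for 0 < γ ≤ 1, the function f(x) = |x|^{(γ−1)(p−1)−1} on the unit ball B_1 ⊂ ℝ^n belongs to the Morrey space L^{1,λ}(B_1) with λ = (γ−1)(p−1) − 1 + n, provided λ > 0; i.e., there is c > 0 with ∫_{B_1 ∩ B_r(x)} |y|^{(γ−1)(p−1)−1} dy ≤ c r^λ for all x ∈ B_1 and r > 0. For γ ≤ 1 and p > 1, one has λ ≤ n − 1. -/
open MeasureTheory Metric Set

lemma norm_rpow_le_indicator_add_one {E : Type*} [SeminormedAddCommGroup E] {a : ℝ} (ha : a ≤ 0)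
    (y : E) :
    ‖y‖ ^ a ≤ (ball 0 1).indicator (fun y : E ↦ ‖y‖ ^ a) y + 1 := by
  by_cases hy : y ∈ ball (0 : E) 1
  · simp [indicator_of_mem hy]
  · rw [indicator_of_notMem hy, zero_add]
    exact Real.rpow_le_one_of_one_le_of_nonpos (by simpa using hy) ha

section PowerWeight

variable {E : Type*} [NormedAddCommGroup E] [NormedSpace ℝ E] [FiniteDimensional ℝ E]
  [MeasurableSpace E] [BorelSpace E] (μ : Measure E) [μ.IsAddHaarMeasure]

open scoped Pointwise

lemma setIntegral_norm_rpow_ball (a : ℝ) (x : E) {r : ℝ} (hr : 0 < r) :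
    ∫ y in ball x r, ‖y‖ ^ a ∂μ
      = r ^ (a + Module.finrank ℝ E) * ∫ y in ball (r⁻¹ • x) 1, ‖y‖ ^ a ∂μ := by
  have h := Measure.setIntegral_comp_smul_of_pos μ (fun y : E ↦ ‖y‖ ^ a) (ball (r⁻¹ • x) 1) hr
  rw [_root_.smul_ball hr.ne', smul_inv_smul₀ hr.ne', Real.norm_of_nonneg hr.le, mul_one,
    smul_eq_mul] at h
  simp_rw [norm_smul, Real.norm_of_nonneg hr.le, Real.mul_rpow hr.le (norm_nonneg _)] at h
  rw [integral_const_mul] at h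
  rw [Real.rpow_add hr, Real.rpow_natCast, mul_right_comm, h]
  field_simp

variable [Nontrivial E]

lemma integrableOn_norm_rpow_ball {a : ℝ} (han : 0 < a + Module.finrank ℝ E) (x : E) (r : ℝ) :
    IntegrableOn (fun y : E ↦ ‖y‖ ^ a) (ball x r) μ := by
  have h : LocallyIntegrable (fun y : E ↦ ‖y‖ ^ a) μ :=
    locallyIntegrable_of_norm_le_rpow (C := 1) (α := -a) Module.finrank_pos (by linarith)
      (.of_forall fun y ↦ by simp [abs_of_nonneg (Real.rpow_nonneg (norm_nonneg y) a)])
      (measurable_norm.pow_const a).aestronglyMeasurable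
  exact (h.integrableOn_isCompact (isCompact_closedBall x r)).mono_set ball_subset_closedBall

lemma setIntegral_norm_rpow_ball_one_le {a : ℝ} (ha : a ≤ 0)
    (han : 0 < a + Module.finrank ℝ E) (x : E) :
    ∫ y in ball x 1, ‖y‖ ^ a ∂μ ≤ ∫ y in ball 0 1, ‖y‖ ^ a ∂μ + μ.real (ball 0 1) := by
  have hI := (integrableOn_norm_rpow_ball μ han 0 1).integrable_indicator measurableSet_ball
  have hc : IntegrableOn (fun _ : E ↦ (1 : ℝ)) (ball x 1) μ :=
    integrableOn_const measure_ball_lt_top.ne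
  calc ∫ y in ball x 1, ‖y‖ ^ a ∂μ
      ≤ ∫ y in ball x 1, ((ball 0 1).indicator (fun y : E ↦ ‖y‖ ^ a) y + 1) ∂μ :=
        setIntegral_mono (integrableOn_norm_rpow_ball μ han x 1) (hI.integrableOn.add hc)
          (norm_rpow_le_indicator_add_one ha)
    _ = ∫ y in ball x 1, (ball 0 1).indicator (fun y : E ↦ ‖y‖ ^ a) y ∂μ
          + μ.real (ball 0 1) := by
        rw [integral_add hI.integrableOn hc, setIntegral_const, smul_eq_mul, mul_one,
          measureReal_def, measureReal_def, Measure.addHaar_ball_center]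
    _ ≤ ∫ y, (ball 0 1).indicator (fun y : E ↦ ‖y‖ ^ a) y ∂μ + μ.real (ball 0 1) := by
        refine add_le_add_left (setIntegral_le_integral hI (.of_forall fun y ↦ ?_)) _
        exact indicator_nonneg (fun y _ ↦ by positivity) y
    _ = ∫ y in ball 0 1, ‖y‖ ^ a ∂μ + μ.real (ball 0 1) := by
        rw [integral_indicator measurableSet_ball]

end PowerWeight

/-- Sharpness of the Morrey exponent: for `0 < γ ≤ 1`, `1 < p < n` and
`λ = (γ-1)(p-1) - 1 + n > 0`, the function `f(x) = |x|^{(γ-1)(p-1)-1}` belongs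
to `L^{1,λ}(B_1)`, i.e. `∫_{B_1 ∩ B_r(x)} |y|^{(γ-1)(p-1)-1} dy ≤ c r^λ`;
moreover `λ ≤ n - 1`. -/
theorem serrin_data_in_morrey
    (n : ℕ) (hn : 2 ≤ n) (p γ lam : ℝ) (hγ0 : 0 < γ) (hγ1 : γ ≤ 1)
    (hp1 : 1 < p) (hpn : p < n)
    (hlam : lam = (γ - 1) * (p - 1) - 1 + n) (hlampos : 0 < lam) :
    (∃ c > (0 : ℝ), ∀ x ∈ Metric.ball (0 : EuclideanSpace ℝ (Fin n)) 1,
      ∀ r : ℝ, 0 < r →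
        ∫ y in Metric.ball (0 : EuclideanSpace ℝ (Fin n)) 1 ∩ Metric.ball x r,
            ‖y‖ ^ ((γ - 1) * (p - 1) - 1) ≤ c * r ^ lam) ∧
    lam ≤ (n : ℝ) - 1 := by
  have hprod : (γ - 1) * (p - 1) ≤ 0 := mul_nonpos_of_nonpos_of_nonneg (by linarith) (by linarith)
  refine ⟨?_, by linarith⟩
  have : Nonempty (Fin n) := ⟨⟨0, by omega⟩⟩
  set a := (γ - 1) * (p - 1) - 1
  have ha : a ≤ 0 := by linarith
  have hdim : a + Module.finrank ℝ (EuclideanSpace ℝ (Fin n)) = lam := by simp [hlam]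
  have han : 0 < a + Module.finrank ℝ (EuclideanSpace ℝ (Fin n)) := hdim ▸ hlampos
  have hvol : 0 < volume.real (ball (0 : EuclideanSpace ℝ (Fin n)) 1) :=
    ENNReal.toReal_pos (measure_ball_pos _ _ one_pos).ne' measure_ball_lt_top.ne
  refine ⟨(∫ y in ball (0 : EuclideanSpace ℝ (Fin n)) 1, ‖y‖ ^ a)
    + volume.real (ball (0 : EuclideanSpace ℝ (Fin n)) 1),
    add_pos_of_nonneg_of_pos (integral_nonneg fun y ↦ by positivity) hvol, fun x _ r hr ↦ ?_⟩
  calc ∫ y in ball 0 1 ∩ ball x r, ‖y‖ ^ a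
      ≤ ∫ y in ball x r, ‖y‖ ^ a :=
        setIntegral_mono_set (integrableOn_norm_rpow_ball volume han x r)
          (.of_forall fun y ↦ by positivity) inter_subset_right.eventuallyLE
    _ = r ^ lam * ∫ y in ball (r⁻¹ • x) 1, ‖y‖ ^ a := by
        rw [setIntegral_norm_rpow_ball volume a x hr, hdim]
    _ ≤ _ := by
        rw [mul_comm]
        gcongr
        exact setIntegral_norm_rpow_ball_one_le volume ha han _
end
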